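/- In the setting of the construction (μ, ν compactly supported atomless probability measures on ℝ, γ̄ an ∞-cyclically monotone optimal plan, φ_r(x) := −ρ((−∞,x]), ψ_r(y) := inf{ −φ_r(x) : x ∈ [y−λ_C, y+λ_C] }), the equality φ_r(x) + ψ_r(y) = 0 holds for γ̄-almost every (x,y). More precisely, if (x̄,ȳ) ∈ supp γ̄ is such that φ_r(x̄)+ψ_r(ȳ) < 0, then x̄ belongs to an at most countable subset of supp μ or ȳ belongs to an at most countable subset of supp ν. -/

import Mathlib

open MeasureTheory Set Filter Topology
open scoped ENNReal NNReal

noncomputable section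

/-- Topological support of a measure: points all of whose open neighborhoods have
positive measure. -/
def mSupport {α : Type*} [TopologicalSpace α] [MeasurableSpace α] (γ : Measure α) : Set α :=
  {x | ∀ U : Set α, IsOpen U → x ∈ U → 0 < γ U}

/-- γ is a transport plan (coupling) between μ and ν. -/
def IsCoupling {α : Type*} [MeasurableSpace α] (μ ν : Measure α) (γ : Measure (α × α)) : Prop :=
  γ.fst = μ ∧ γ.snd = ν

/-- The γ-essential supremum of the distance |x - y|. -/
def costInf {α : Type*} [MeasurableSpace α] [PseudoEMetricSpace α]
    (γ : Measure (α × α)) : ℝ≥0∞ :=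
  essSup (fun p => edist p.1 p.2) γ

/-- The L^∞ optimal transport cost W∞(μ, ν). -/
def Winfty {α : Type*} [MeasurableSpace α] [PseudoEMetricSpace α] (μ ν : Measure α) : ℝ≥0∞ :=
  ⨅ (γ : Measure (α × α)) (_ : IsCoupling μ ν γ), costInf γ

/-- γ is an optimal plan for the L^∞ optimal transport problem. -/
def IsOptimalPlan {α : Type*} [MeasurableSpace α] [PseudoEMetricSpace α]
    (μ ν : Measure α) (γ : Measure (α × α)) : Prop :=
  IsCoupling μ ν γ ∧ costInf γ = Winfty μ ν

/-- μ is compactly supported. -/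
def CompactlySupported {α : Type*} [TopologicalSpace α] [MeasurableSpace α]
    (μ : Measure α) : Prop :=
  ∃ K : Set α, IsCompact K ∧ μ Kᶜ = 0

/-- The admissible class U_λ of the dual problem. -/
def DualAdm {α : Type*} [MeasurableSpace α] [PseudoMetricSpace α]
    (μ ν : Measure α) (lam : ℝ) (φ ψ : α → ℝ) : Prop :=
  Integrable φ μ ∧ Integrable ψ ν ∧
    ∀ᵐ x ∂μ, ∀ᵐ y ∂ν, dist x y ≤ lam → φ x + ψ y ≤ 0

/-- ∞-cyclical monotonicity of a plan on ℝ. -/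
def InfCM (γ : Measure (ℝ × ℝ)) : Prop :=
  ∀ (n : ℕ) (p : Fin (n + 1) → ℝ × ℝ), (∀ i, p i ∈ mSupport γ) →
    (⨆ i, |(p i).1 - (p i).2|) ≤ ⨆ i, |(p i).1 - (p (i + 1)).2|

/-- Points moved at maximal distance to the right. -/
def Mplus (γ : Measure (ℝ × ℝ)) (lam : ℝ) : Set ℝ := {x | (x, x + lam) ∈ mSupport γ}

/-- Points moved at maximal distance to the left. -/
def Mminus (γ : Measure (ℝ × ℝ)) (lam : ℝ) : Set ℝ := {x | (x, x - lam) ∈ mSupport γ}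


/-- x is a left-extreme point of A: x ∈ A and some interval (x−δ, x) misses A. -/
def LeftExtreme (A : Set ℝ) (x : ℝ) : Prop :=
  x ∈ A ∧ ∃ δ > 0, Set.Ioo (x - δ) x ∩ A = ∅

/-- x is a right-extreme point of A: x ∈ A and some interval (x, x+δ) misses A. -/
def RightExtreme (A : Set ℝ) (x : ℝ) : Prop :=
  x ∈ A ∧ ∃ δ > 0, Set.Ioo x (x + δ) ∩ A = ∅

/-- Support of the signed measure ρ = ρ⁺ − ρ⁻: points each of whose open
neighborhoods contains a measurable set on which ρ⁺ and ρ⁻ differ. -/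
def suppSigned (ρp ρm : Measure ℝ) : Set ℝ :=
  {x | ∀ U : Set ℝ, IsOpen U → x ∈ U → ∃ A ⊆ U, MeasurableSet A ∧ ρp A ≠ ρm A}

/-- The potential φ_r(x) = −ρ((−∞, x]) where ρ = ρ⁺ − ρ⁻. -/
def phiR (ρp ρm : Measure ℝ) (x : ℝ) : ℝ :=
  (ρm (Set.Iic x)).toReal - (ρp (Set.Iic x)).toReal

/-- The potential ψ_r(y) = inf { −φ_r(x) : x ∈ [y − λ, y + λ] }. -/
def psiR (ρp ρm : Measure ℝ) (lam : ℝ) (y : ℝ) : ℝ :=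
  sInf ((fun x => -phiR ρp ρm x) '' Set.Icc (y - lam) (y + lam))

lemma mSupport_eq_support {α : Type*} [TopologicalSpace α] [MeasurableSpace α] (γ : Measure α) :
    mSupport γ = γ.support := by
  rw [Measure.support_eq_forall_isOpen]
  ext x
  exact ⟨fun h U hx hU => h U hU hx, fun h U hU hx => h U hx hU⟩

lemma setOf_leftExtreme_countable (A : Set ℝ) : {x | LeftExtreme A x}.Countable := by
  refine (countable_setOfPred_isolated_left_within (s := A)).mono ?_
  rintro x ⟨hx, δ, hδ, hA⟩
  refine ⟨hx, empty_mem_iff_bot.1 (mem_nhdsWithin.2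
    ⟨Ioi (x - δ), isOpen_Ioi, sub_lt_self x hδ, ?_⟩)⟩
  rintro y ⟨hy, hyA, hyx⟩
  exact hA.subset ⟨⟨hy, hyx⟩, hyA⟩

lemma fst_mem_mSupport {μ ν : Measure ℝ} {γ : Measure (ℝ × ℝ)} (h : IsCoupling μ ν γ)
    {p : ℝ × ℝ} (hp : p ∈ mSupport γ) : p.1 ∈ mSupport μ := by
  intro U hU hpU
  rw [← h.1, Measure.fst_apply hU.measurableSet]
  exact hp _ (hU.preimage continuous_fst) hpU

lemma snd_mem_mSupport {μ ν : Measure ℝ} {γ : Measure (ℝ × ℝ)} (h : IsCoupling μ ν γ)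
    {p : ℝ × ℝ} (hp : p ∈ mSupport γ) : p.2 ∈ mSupport ν := by
  intro U hU hpU
  rw [← h.2, Measure.snd_apply hU.measurableSet]
  exact hp _ (hU.preimage continuous_snd) hpU

lemma CompactlySupported.exists_ae_abs_le {μ : Measure ℝ} (h : CompactlySupported μ) :
    ∃ R : ℝ, ∀ᵐ x ∂μ, |x| ≤ R := by
  obtain ⟨K, hK, hμK⟩ := h
  obtain ⟨R, hR⟩ := hK.isBounded.subset_closedBall 0
  refine ⟨R, ?_⟩
  filter_upwards [measure_eq_zero_iff_ae_notMem.1 hμK] with x hx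
  simpa using hR (not_not.1 hx)

lemma IsCoupling.ae_fst {μ ν : Measure ℝ} {γ : Measure (ℝ × ℝ)} (h : IsCoupling μ ν γ)
    {P : ℝ → Prop} (hP : ∀ᵐ x ∂μ, P x) : ∀ᵐ p ∂γ, P p.1 := by
  rw [← h.1] at hP
  exact ae_of_ae_map measurable_fst.aemeasurable hP

lemma IsCoupling.ae_snd {μ ν : Measure ℝ} {γ : Measure (ℝ × ℝ)} (h : IsCoupling μ ν γ)
    {P : ℝ → Prop} (hP : ∀ᵐ x ∂ν, P x) : ∀ᵐ p ∂γ, P p.2 := by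
  rw [← h.2] at hP
  exact ae_of_ae_map measurable_snd.aemeasurable hP

lemma IsOptimalPlan.Winfty_ne_top {μ ν : Measure ℝ} {γ : Measure (ℝ × ℝ)}
    (hμ : CompactlySupported μ) (hν : CompactlySupported ν) (hγ : IsOptimalPlan μ ν γ) :
    Winfty μ ν ≠ ∞ := by
  obtain ⟨R, hR⟩ := hμ.exists_ae_abs_le
  obtain ⟨R', hR'⟩ := hν.exists_ae_abs_le
  rw [← hγ.2]
  refine ne_top_of_le_ne_top (b := ENNReal.ofReal (R + R')) ENNReal.ofReal_ne_top ?_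
  refine essSup_le_of_ae_le _ ?_
  filter_upwards [hγ.1.ae_fst hR, hγ.1.ae_snd hR'] with p h1 h2
  rw [edist_dist, Real.dist_eq]
  exact ENNReal.ofReal_le_ofReal ((abs_sub _ _).trans (add_le_add h1 h2))

/-- The support of an optimal plan lies in the closed strip of width `W∞` around the diagonal. -/
lemma IsOptimalPlan.abs_sub_le {μ ν : Measure ℝ} {γ : Measure (ℝ × ℝ)}
    (hμ : CompactlySupported μ) (hν : CompactlySupported ν) (hγ : IsOptimalPlan μ ν γ)
    {p : ℝ × ℝ} (hp : p ∈ mSupport γ) : |p.1 - p.2| ≤ (Winfty μ ν).toReal := by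
  have hcl : IsClosed {p : ℝ × ℝ | |p.1 - p.2| ≤ (Winfty μ ν).toReal} :=
    isClosed_le (by fun_prop) (by fun_prop)
  rw [mSupport_eq_support] at hp
  refine Measure.support_subset_of_isClosed hcl ?_ hp
  filter_upwards [ENNReal.ae_le_essSup (μ := γ) fun p : ℝ × ℝ => edist p.1 p.2] with q hq
  have hq' : edist q.1 q.2 ≤ Winfty μ ν := hγ.2 ▸ hq
  have := ENNReal.toReal_mono (hγ.Winfty_ne_top hμ hν) hq'
  rwa [← dist_edist, Real.dist_eq] at this

lemma InfCM.le_or_le {γ : Measure (ℝ × ℝ)} (h : InfCM γ) {p q : ℝ × ℝ}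
    (hp : p ∈ mSupport γ) (hq : q ∈ mSupport γ) :
    |q.1 - q.2| ≤ |p.1 - q.2| ∨ |q.1 - q.2| ≤ |q.1 - p.2| := by
  have key := h 1 ![p, q] (by intro i; fin_cases i <;> simpa)
  have h1 : |q.1 - q.2| ≤ ⨆ i, |(![p, q] i).1 - (![p, q] i).2| :=
    le_ciSup (f := fun i => |(![p, q] i).1 - (![p, q] i).2|) (Set.finite_range _).bddAbove 1
  have h2 : (⨆ i, |(![p, q] i).1 - (![p, q] (i + 1)).2|) ≤ max |p.1 - q.2| |q.1 - p.2| := by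
    refine ciSup_le fun i => ?_
    fin_cases i
    · exact le_max_left _ _
    · exact le_max_right _ _
  exact le_max_iff.1 (h1.trans (key.trans h2))

/-- The distribution function `-φ_r` is that of `ρ⁺ - ρ⁻`. -/
lemma neg_phiR (ρp ρm : Measure ℝ) (x : ℝ) :
    -phiR ρp ρm x = ρp.real (Iic x) - ρm.real (Iic x) := by
  simp [phiR, Measure.real]

lemma real_Ioc_eq (ρ : Measure ℝ) [IsFiniteMeasure ρ] {a b : ℝ} (h : a ≤ b) :
    ρ.real (Ioc a b) = ρ.real (Iic b) - ρ.real (Iic a) := by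
  have hd : Ioc a b = Iic b \ Iic a := by
    ext x
    simp [and_comm]
  rw [hd, measureReal_sdiff (Iic_subset_Iic.2 h) measurableSet_Iic]

lemma exists_mem_mSupport_of_real_pos {ρ : Measure ℝ} {s : Set ℝ} (h : 0 < ρ.real s) :
    ∃ z ∈ s, z ∈ mSupport ρ := by
  rw [mSupport_eq_support]
  exact Measure.nonempty_inter_support_of_pos (ENNReal.toReal_pos_iff.1 h).1

lemma bddBelow_neg_phiR (ρp ρm : Measure ℝ) [IsFiniteMeasure ρm] (s : Set ℝ) :
    BddBelow ((fun x => -phiR ρp ρm x) '' s) := by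
  refine ⟨-ρm.real univ, ?_⟩
  rintro _ ⟨x, -, rfl⟩
  have h1 := measureReal_mono (μ := ρm) (subset_univ (Iic x))
  have h2 : 0 ≤ ρp.real (Iic x) := measureReal_nonneg
  simp only [neg_phiR]
  linarith

lemma phiR_add_psiR_nonpos (ρp ρm : Measure ℝ) [IsFiniteMeasure ρm] {lam x y : ℝ}
    (h : |x - y| ≤ lam) : phiR ρp ρm x + psiR ρp ρm lam y ≤ 0 := by
  have hle : psiR ρp ρm lam y ≤ -phiR ρp ρm x := by
    refine csInf_le (bddBelow_neg_phiR ρp ρm _) ⟨x, ?_, rfl⟩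
    obtain ⟨h1, h2⟩ := abs_le.1 h
    exact ⟨by linarith, by linarith⟩
  linarith

/-- Where saturation fails, the first coordinate is a left-extreme point of `M⁺`, or the second
one is a left-extreme point of `M⁻` shifted to the left by `lam`. -/
lemma leftExtreme_of_phiR_add_psiR_neg {γ : Measure (ℝ × ℝ)} (hcm : InfCM γ) {lam : ℝ}
    (hstrip : ∀ p ∈ mSupport γ, |p.1 - p.2| ≤ lam)
    {ρp ρm : Measure ℝ} [IsFiniteMeasure ρp] [IsFiniteMeasure ρm]
    (hsp : mSupport ρp = Mplus γ lam) (hsm : mSupport ρm = Mminus γ lam)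
    {p : ℝ × ℝ} (hp : p ∈ mSupport γ) (hneg : phiR ρp ρm p.1 + psiR ρp ρm lam p.2 < 0) :
    LeftExtreme (Mplus γ lam) p.1 ∨ LeftExtreme (Mminus γ lam) (p.2 + lam) := by
  obtain ⟨h1, h2⟩ := abs_le.1 (hstrip p hp)
  have hlam : |lam| = lam := abs_of_nonneg ((abs_nonneg _).trans (hstrip p hp))
  obtain ⟨_, ⟨x, ⟨hx1, hx2⟩, rfl⟩, hlt⟩ :=
    exists_lt_of_csInf_lt (b := -phiR ρp ρm p.1)
      (s := (fun x => -phiR ρp ρm x) '' Icc (p.2 - lam) (p.2 + lam))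
      ⟨_, p.1, ⟨by linarith, by linarith⟩, rfl⟩ (by unfold psiR at hneg; linarith)
  simp only [neg_phiR] at hlt
  rcases lt_trichotomy x p.1 with hxp | hxp | hxp
  · left
    have hM : ∀ z ∈ Ioc x p.1, z ∈ Mplus γ lam → z = p.1 := by
      rintro z ⟨hz1, hz2⟩ hz
      by_contra hne
      have hz2 := lt_of_le_of_ne hz2 hne
      have hcyc := hcm.le_or_le hp hz
      simp only [sub_add_cancel_left, abs_neg, hlam] at hcyc
      rcases hcyc with h | h <;> rcases le_abs.1 h with h | h <;> linarith
    have hpos : 0 < ρp.real (Ioc x p.1) := by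
      have := measureReal_nonneg (μ := ρm) (s := Ioc x p.1)
      rw [real_Ioc_eq _ hxp.le] at this ⊢
      linarith
    obtain ⟨z, hz, hzs⟩ := exists_mem_mSupport_of_real_pos hpos
    rw [hsp] at hzs
    refine ⟨hM z hz hzs ▸ hzs, p.1 - x, by linarith, ?_⟩
    rw [sub_sub_cancel]
    exact eq_empty_of_forall_notMem fun w ⟨hw, hwM⟩ => hw.2.ne (hM w ⟨hw.1, hw.2.le⟩ hwM)
  · rw [hxp] at hlt
    exact absurd hlt (lt_irrefl _)
  · right
    have hM : ∀ z ∈ Ioc p.1 x, z ∈ Mminus γ lam → z = p.2 + lam := by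
      rintro z ⟨hz1, hz2⟩ hz
      by_contra hne
      have hz2 := lt_of_le_of_ne (hz2.trans hx2) hne
      have hcyc := hcm.le_or_le hp hz
      simp only [sub_sub_cancel, hlam] at hcyc
      rcases hcyc with h | h <;> rcases le_abs.1 h with h | h <;> linarith
    have hpos : 0 < ρm.real (Ioc p.1 x) := by
      have := measureReal_nonneg (μ := ρp) (s := Ioc p.1 x)
      rw [real_Ioc_eq _ hxp.le] at this ⊢
      linarith
    obtain ⟨z, hz, hzs⟩ := exists_mem_mSupport_of_real_pos hpos
    rw [hsm] at hzs
    obtain rfl := hM z hz hzs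
    have hx : x = p.2 + lam := le_antisymm hx2 hz.2
    refine ⟨hzs, p.2 + lam - p.1, by linarith [hz.1], ?_⟩
    rw [sub_sub_cancel]
    exact eq_empty_of_forall_notMem fun w ⟨hw, hwM⟩ =>
      hw.2.ne (hM w ⟨hw.1, hx ▸ hw.2.le⟩ hwM)

/-- φ_r(x) + ψ_r(y) = 0 for γ̄-a.e. (x,y); more precisely, the points (x̄,ȳ) of supp γ̄
where φ_r(x̄) + ψ_r(ȳ) < 0 have first coordinate in an at most countable subset of
supp μ or second coordinate in an at most countable subset of supp ν. -/
theorem phiR_psiR_saturated_on_support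
    (μ ν : Measure ℝ)
    [IsProbabilityMeasure μ] [IsProbabilityMeasure ν] [NullSingletonClass μ] [NullSingletonClass ν]
    (hμ : CompactlySupported μ) (hν : CompactlySupported ν)
    (γ : Measure (ℝ × ℝ)) (hγ : IsOptimalPlan μ ν γ) (hcm : InfCM γ)
    (ρp ρm : Measure ℝ) [IsFiniteMeasure ρp] [IsFiniteMeasure ρm]
    (hsp : mSupport ρp = Mplus γ (Winfty μ ν).toReal)
    (hsm : mSupport ρm = Mminus γ (Winfty μ ν).toReal)
    (hss : suppSigned ρp ρm = Mplus γ (Winfty μ ν).toReal ∪ Mminus γ (Winfty μ ν).toReal)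
    (hatom : ∀ x₀, (LeftExtreme (Mplus γ (Winfty μ ν).toReal) x₀ ∨
        RightExtreme (Mplus γ (Winfty μ ν).toReal) x₀) → ρm {x₀} < ρp {x₀})
    :
    (∀ᵐ p ∂γ, phiR ρp ρm p.1 + psiR ρp ρm (Winfty μ ν).toReal p.2 = 0) ∧
    ∃ S T : Set ℝ, S.Countable ∧ T.Countable ∧ S ⊆ mSupport μ ∧ T ⊆ mSupport ν ∧
      ∀ p ∈ mSupport γ,
        phiR ρp ρm p.1 + psiR ρp ρm (Winfty μ ν).toReal p.2 < 0 →
        p.1 ∈ S ∨ p.2 ∈ T := by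
  set lam := (Winfty μ ν).toReal with hlam
  have hstrip : ∀ p ∈ mSupport γ, |p.1 - p.2| ≤ lam := fun p hp => hγ.abs_sub_le hμ hν hp
  set S : Set ℝ := {x | LeftExtreme (Mplus γ lam) x}
  set T : Set ℝ := (fun x => x - lam) '' {x | LeftExtreme (Mminus γ lam) x}
  have hS : S.Countable := setOf_leftExtreme_countable _
  have hT : T.Countable := (setOf_leftExtreme_countable _).image _
  have hST : ∀ p ∈ mSupport γ, phiR ρp ρm p.1 + psiR ρp ρm lam p.2 < 0 → p.1 ∈ S ∨ p.2 ∈ T :=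
    fun p hp hneg => (leftExtreme_of_phiR_add_psiR_neg hcm hstrip hsp hsm hp hneg).imp_right
      fun h => ⟨_, h, add_sub_cancel_right _ _⟩
  refine ⟨?_, S, T, hS, hT, fun x hx => fst_mem_mSupport hγ.1 hx.1, ?_, hST⟩
  · have hsupp : ∀ᵐ p ∂γ, p ∈ mSupport γ := by
      rw [mSupport_eq_support]
      exact Measure.support_mem_ae
    filter_upwards [hsupp, hγ.1.ae_fst (measure_eq_zero_iff_ae_notMem.1 (hS.measure_zero μ)),
      hγ.1.ae_snd (measure_eq_zero_iff_ae_notMem.1 (hT.measure_zero ν))] with p hp hpS hpT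
    refine le_antisymm (phiR_add_psiR_nonpos ρp ρm (hstrip p hp)) (not_lt.1 fun hneg => ?_)
    exact (hST p hp hneg).elim hpS hpT
  · rintro _ ⟨x, hx, rfl⟩
    exact snd_mem_mSupport hγ.1 hx.1

end
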